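/- Let h be a solution of rank n−1 of two nontrivial word equations E and E' in n unknowns, and let h' be a solution of E of rank n−1 that is not a solution of E'. Then h and h' are not linearly equivalent, i.e., Γ_h ≠ Γ_{h'}. -/

import Mathlib

open scoped BigOperators

namespace WordEquations

/-- The set of letters occurring in the images of a (letter-image) morphism. -/
def alph {Ξ Δ : Type*} (h : Ξ → List Δ) : Set Δ := ⋃ x, {a | a ∈ h x}

/-- `h` is a solution of the system `T` of word equations. -/
def IsSolution {Ξ A : Type*} (h : Ξ → List A) (T : Set (List Ξ × List Ξ)) : Prop :=
  ∀ e ∈ T, e.1.flatMap h = e.2.flatMap h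

/-- `h` is a solution of the single word equation `E`. -/
def IsSolutionE {Ξ A : Type*} (h : Ξ → List A) (E : List Ξ × List Ξ) : Prop :=
  E.1.flatMap h = E.2.flatMap h

/-- `θ` is a renaming of letters on the set `S`: it maps each letter of `S` to a
single letter, injectively on `S`. -/
def IsRenamingOn {A B : Type*} (θ : A → List B) (S : Set A) : Prop :=
  (∀ a ∈ S, ∃ b, θ a = [b]) ∧ ∀ a₁ ∈ S, ∀ a₂ ∈ S, θ a₁ = θ a₂ → a₁ = a₂

/-- `g` is a principal solution of `T`: whenever `g = θ ∘ g'` for a solution `g'`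
(and a morphism `θ` non-erasing on `alph g'`), `θ` is a renaming of letters. -/
def IsPrincipalSolution {Ξ Δ : Type*} (g : Ξ → List Δ) (T : Set (List Ξ × List Ξ)) : Prop :=
  IsSolution g T ∧
  ∀ (Δ' : Type) (g' : Ξ → List Δ') (θ : Δ' → List Δ),
    IsSolution g' T → (∀ a ∈ alph g', θ a ≠ []) →
    (∀ x, g x = (g' x).flatMap θ) → IsRenamingOn θ (alph g')

/-- The vector `γ(h)_a = (|h(x₁)|_a, …, |h(xₙ)|_a) ∈ ℚⁿ`. -/
def gamVec {n : ℕ} {Δ : Type*} [DecidableEq Δ] (h : Fin n → List Δ) (a : Δ) :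
    Fin n → ℚ := fun j => ((h j).count a : ℚ)

/-- `Γ_h`, the ℚ-span of the vectors `γ(h)_a`. -/
noncomputable def GammaSpace {n : ℕ} {Δ : Type*} [DecidableEq Δ] (h : Fin n → List Δ) :
    Submodule ℚ (Fin n → ℚ) := Submodule.span ℚ (Set.range (gamVec h))

/-- The rank of a morphism: `dim Γ_h`. -/
noncomputable def morphRank {n : ℕ} {Δ : Type*} [DecidableEq Δ] (h : Fin n → List Δ) : ℕ :=
  Module.finrank ℚ ↥(GammaSpace h)

/-- `Mℕ`: all finite nonempty sums `Σᵢ aᵢ αᵢ` with `aᵢ` positive integers and `αᵢ ∈ M`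
(equivalently, nonempty finite sums of elements of `M` with repetitions). -/
def natSums {n : ℕ} (M : Set (Fin n → ℚ)) : Set (Fin n → ℚ) :=
  {v | ∃ l : List (Fin n → ℚ), l ≠ [] ∧ (∀ x ∈ l, x ∈ M) ∧ l.sum = v}

/-- `M ⊆ ℚⁿ` has rank `r`: the ℚ-span of `M` has dimension `r`, and `M` is not contained
in any finite union of `(r-1)`-dimensional subspaces of its span. -/
def HasRank {n : ℕ} (M : Set (Fin n → ℚ)) (r : ℕ) : Prop :=
  Module.finrank ℚ ↥(Submodule.span ℚ M) = r ∧
  ∀ V : Finset (Submodule ℚ (Fin n → ℚ)),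
    (∀ W ∈ V, W ≤ Submodule.span ℚ M ∧ Module.finrank ℚ ↥W + 1 = r) →
    ¬ M ⊆ ⋃ W ∈ V, (W : Set (Fin n → ℚ))

/-- The monomial `X^α = ∏ᵢ Xᵢ^{αᵢ}` in `ℤ[X₁,…,Xₙ]`. -/
noncomputable def Xpow {n : ℕ} (α : Fin n → ℕ) : MvPolynomial (Fin n) ℤ :=
  ∏ i, MvPolynomial.X i ^ α i

/-- The polynomial `Σ_{a : w_a = j} ∏_{t<a} X_{w_t}` associated with one side of an equation. -/
noncomputable def sideS {n : ℕ} (w : List (Fin n)) (j : Fin n) : MvPolynomial (Fin n) ℤ :=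
  ∑ a : Fin w.length, if w.get a = j then ((w.take (a : ℕ)).map MvPolynomial.X).prod else 0

/-- The polynomial `S_{E,x_j}` of the equation `E = (u,v)`. -/
noncomputable def SE {n : ℕ} (E : List (Fin n) × List (Fin n)) (j : Fin n) :
    MvPolynomial (Fin n) ℤ :=
  sideS E.1 j - sideS E.2 j

/-- Evaluation `p ↦ p(β)`, induced by `Xᵢ ↦ x^{βᵢ}`. -/
noncomputable def evalAt {n : ℕ} (β : Fin n → ℕ) (p : MvPolynomial (Fin n) ℤ) : Polynomial ℤ :=
  MvPolynomial.eval₂ (Int.castRingHom (Polynomial ℤ)) (fun i => Polynomial.X ^ β i) p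

/-- `λ⁺`, the positive part of an integer vector. -/
def lamPos {n : ℕ} (lam : Fin n → ℤ) : Fin n → ℕ := fun i => (lam i).toNat

/-- `λ⁻`, the negative part of an integer vector. -/
def lamNeg {n : ℕ} (lam : Fin n → ℤ) : Fin n → ℕ := fun i => (-(lam i)).toNat

/-- The length type `L(θ_α ∘ h)` of the composition of `h` with the power morphism
`θ_α : aᵢ ↦ aᵢ^{αᵢ}`. -/
def powLenType {n k : ℕ} (α : Fin k → ℕ) (h : Fin n → List (Fin k)) : Fin n → ℕ :=
  fun x => ∑ a, α a * (h x).count a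

/-- The field `ℚ(x)`, realized as the field of fractions of `ℤ[x]`. -/
noncomputable abbrev RatX : Type := FractionRing (Polynomial ℤ)

/-- The vector `𝒮_E(β) ∈ ℚ(x)ⁿ`. -/
noncomputable def SEvec {n : ℕ} (E : List (Fin n) × List (Fin n)) (β : Fin n → ℕ) :
    Fin n → RatX :=
  fun j => algebraMap (Polynomial ℤ) RatX (evalAt β (SE E j))

/-- The set of exponents of the minimal monomials of `p` (exponents in the support of `p`
that are minimal with respect to the componentwise order). -/
noncomputable def minimalSupport {n : ℕ} (p : MvPolynomial (Fin n) ℤ) : Finset (Fin n →₀ ℕ) :=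
  p.support.filter (fun β => ∀ β' ∈ p.support, β' ≤ β → β' = β)


/-- Fox-derivative vector of a word, with weights `X`. -/
def fox {ι R : Type*} [DecidableEq ι] [CommRing R] (X : ι → R) : List ι → ι → R
  | [] => 0
  | a :: w => Pi.single a 1 + X a • fox X w

theorem fox_append {ι R : Type*} [DecidableEq ι] [CommRing R] (X : ι → R) (u v : List ι) :
    fox X (u ++ v) = fox X u + (u.map X).prod • fox X v := by
  induction u with
  | nil => simp [fox]
  | cons a u ih => simp [fox, ih, smul_add, smul_smul, add_assoc]

theorem fox_map {ι R S : Type*} [DecidableEq ι] [CommRing R] [CommRing S] (f : R →+* S)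
    (X : ι → R) (u : List ι) (j : ι) :
    f (fox X u j) = fox (fun i => f (X i)) u j := by
  induction u with
  | nil => simp [fox]
  | cons a u ih =>
    simp only [fox, Pi.add_apply, Pi.smul_apply, smul_eq_mul, map_add, map_mul, ih]
    by_cases h : j = a
    · subst h; simp
    · simp [h]

theorem fox_one {ι R : Type*} [DecidableEq ι] [CommRing R] (u : List ι) (j : ι) :
    fox (fun _ => (1 : R)) u j = (u.count j : R) := by
  induction u with
  | nil => simp [fox]
  | cons a u ih =>
    simp only [fox, Pi.add_apply, Pi.smul_apply, smul_eq_mul, ih, List.count_cons]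
    by_cases h : j = a
    · subst h; simp [add_comm]
    · simp [h, Ne.symm h]

theorem fox_flatMap {ι Δ R : Type*} [Fintype ι] [DecidableEq ι] [DecidableEq Δ] [CommRing R]
    (t : Δ → R) (h : ι → List Δ) (u : List ι) (a : Δ) :
    fox t (u.flatMap h) a = ∑ j, fox (fun j => ((h j).map t).prod) u j * fox t (h j) a := by
  induction u with
  | nil => simp [fox]
  | cons b u ih =>
    simp only [List.flatMap_cons, fox_append, fox, Pi.add_apply, Pi.smul_apply, smul_eq_mul, ih,
      add_mul, Finset.sum_add_distrib, Finset.mul_sum, mul_assoc]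
    congr 1
    simp [Pi.single_apply]

theorem fox_nonneg {ι : Type*} [DecidableEq ι] (X : ι → ℚ) (hX : ∀ i, 0 ≤ X i) (u : List ι)
    (j : ι) : 0 ≤ fox X u j := by
  induction u with
  | nil => simp [fox]
  | cons a u ih =>
    simp only [fox, Pi.add_apply, Pi.smul_apply, smul_eq_mul, Pi.single_apply]
    have := mul_nonneg (hX a) ih
    split_ifs <;> linarith

theorem fox_inj_aux {ι R : Type*} [DecidableEq ι] [CommRing R]
    (c : R →+* ℚ) (X : ι → R) (hX : ∀ i, 0 ≤ c (X i)) (a b : ι) (hab : a ≠ b)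
    (h0 : c (X a) = 0) (u v : List ι) : fox X (a :: u) ≠ fox X (b :: v) := by
  intro h
  have h1 := congrArg c (congrFun h b)
  simp only [fox, Pi.add_apply, Pi.smul_apply, smul_eq_mul, map_add, map_mul, h0,
    fox_map] at h1
  rw [Pi.single_eq_of_ne hab.symm, Pi.single_eq_same] at h1
  have h2 := mul_nonneg (hX b) (fox_nonneg _ hX v b)
  simp at h1
  linarith

theorem fox_ne_nil {ι R : Type*} [DecidableEq ι] [CommRing R]
    (c : R →+* ℚ) (X : ι → R) (hX : ∀ i, 0 ≤ c (X i)) (b : ι) (v : List ι) :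
    fox X (b :: v) ≠ fox X [] := by
  intro h
  have h1 := congrArg c (congrFun h b)
  simp only [fox, Pi.add_apply, Pi.smul_apply, smul_eq_mul, map_add, map_mul,
    fox_map] at h1
  rw [Pi.single_eq_same] at h1
  have h2 := mul_nonneg (hX b) (fox_nonneg _ hX v b)
  simp at h1
  linarith

theorem fox_inj {ι R : Type*} [DecidableEq ι] [CommRing R] [IsDomain R]
    (c : R →+* ℚ) (X : ι → R) (hX : ∀ i, 0 ≤ c (X i)) (hne : ∀ i, X i ≠ 0)
    (h2 : ∀ i j, i ≠ j → c (X i) = 0 ∨ c (X j) = 0) (u v : List ι)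
    (h : fox X u = fox X v) : u = v := by
  induction u generalizing v with
  | nil =>
    cases v with
    | nil => rfl
    | cons b v => exact absurd h.symm (fox_ne_nil c X hX b v)
  | cons a u ih =>
    cases v with
    | nil => exact absurd h (fox_ne_nil c X hX a u)
    | cons b v =>
      by_cases hab : a = b
      · subst hab
        congr 1
        apply ih
        simp only [fox] at h
        have h3 := add_left_cancel h
        funext j
        have := congrFun h3 j
        simp only [Pi.smul_apply, smul_eq_mul] at this
        exact mul_left_cancel₀ (hne a) this
      · rcases h2 a b hab with h0 | h0
        · exact absurd h (fox_inj_aux c X hX a b hab h0 u v)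
        · exact absurd h.symm (fox_inj_aux c X hX b a (Ne.symm hab) h0 v u)

open MvPolynomial in
/-- Weight of `h j`. -/
noncomputable def wt {n k : ℕ} (h : Fin n → List (Fin k)) (j : Fin n) :
    MvPolynomial (Fin k) ℚ := ((h j).map X).prod

/-- exponent of the weight -/
noncomputable def expo {n k : ℕ} (h : Fin n → List (Fin k)) (m : Fin n →₀ ℕ) : Fin k →₀ ℕ :=
  Finsupp.equivFunOnFinite.symm (fun a => ∑ j, m j * (h j).count a)

theorem prod_X_eq {k : ℕ} (w : List (Fin k)) :
    (w.map (MvPolynomial.X (R := ℚ))).prod =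
      MvPolynomial.monomial (Finsupp.equivFunOnFinite.symm (fun a => w.count a)) 1 := by
  induction w with
  | nil =>
    simp only [List.map_nil, List.prod_nil, List.count_nil]
    rw [MvPolynomial.one_def]
    congr 2
    ext a
    simp
  | cons b w ih =>
    rw [List.map_cons, List.prod_cons, ih, MvPolynomial.X, MvPolynomial.monomial_mul, one_mul]
    congr 2
    ext a
    simp [List.count_cons, Finsupp.single_apply, add_comm]

theorem aeval_monomial_wt {n k : ℕ} (h : Fin n → List (Fin k)) (m : Fin n →₀ ℕ) (r : ℚ) :
    MvPolynomial.aeval (wt h) (MvPolynomial.monomial m r) =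
      MvPolynomial.monomial (expo h m) r := by
  rw [MvPolynomial.aeval_monomial, Finsupp.prod_fintype _ _ (by simp)]
  simp only [wt, prod_X_eq, MvPolynomial.monomial_pow, one_pow]
  rw [← MvPolynomial.monomial_sum_one, MvPolynomial.algebraMap_eq, MvPolynomial.C_mul_monomial,
    mul_one]
  congr 2
  ext a
  simp [expo, Finsupp.finsetSum_apply]

theorem coeff_aeval_wt {n k : ℕ} (h : Fin n → List (Fin k)) (p : MvPolynomial (Fin n) ℚ)
    (e : Fin k →₀ ℕ) :
    MvPolynomial.coeff e (MvPolynomial.aeval (wt h) p) =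
      ∑ m ∈ p.support, if expo h m = e then p.coeff m else 0 := by
  conv_lhs => rw [p.as_sum]
  rw [map_sum, MvPolynomial.coeff_sum]
  simp only [aeval_monomial_wt, MvPolynomial.coeff_monomial]

theorem ker_transfer {n k l : ℕ} (h : Fin n → List (Fin k)) (h' : Fin n → List (Fin l))
    (hh : ∀ m m', expo h' m = expo h' m' ↔ expo h m = expo h m')
    (p : MvPolynomial (Fin n) ℚ) (hp : MvPolynomial.aeval (wt h) p = 0) :
    MvPolynomial.aeval (wt h') p = 0 := by
  ext e
  rw [coeff_aeval_wt, MvPolynomial.coeff_zero]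
  by_cases he : ∃ m₀, expo h' m₀ = e
  · obtain ⟨m₀, rfl⟩ := he
    simp only [hh]
    rw [← coeff_aeval_wt, hp, MvPolynomial.coeff_zero]
  · push Not at he
    exact Finset.sum_eq_zero (fun m _ => by simp [he m])

theorem expo_iff {n k : ℕ} (h : Fin n → List (Fin k)) (m m' : Fin n →₀ ℕ) :
    expo h m = expo h m' ↔ ∀ g ∈ GammaSpace h, ∑ j, ((m j : ℚ) - m' j) * g j = 0 := by
  constructor
  · intro he g hg
    induction hg using Submodule.span_induction with
    | mem g hg =>
      obtain ⟨a, rfl⟩ := hg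
      have h1 := DFunLike.congr_fun he a
      simp only [expo, Finsupp.equivFunOnFinite_symm_apply_apply] at h1
      have h2 := congrArg (Nat.cast : ℕ → ℚ) h1
      push_cast at h2
      simp only [gamVec, sub_mul, Finset.sum_sub_distrib, h2, sub_self]
    | zero => simp
    | add x y _ _ hx hy => simp [mul_add, Finset.sum_add_distrib, hx, hy]
    | smul r x _ hx =>
      simp only [Pi.smul_apply, smul_eq_mul, mul_left_comm _ r, ← Finset.mul_sum, hx, mul_zero]
  · intro H
    ext a
    have h1 := H (gamVec h a) (Submodule.subset_span ⟨a, rfl⟩)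
    simp only [gamVec, sub_mul, Finset.sum_sub_distrib, sub_eq_zero] at h1
    simp only [expo, Finsupp.equivFunOnFinite_symm_apply_apply]
    exact_mod_cast h1

theorem exists_compl_vec {n : ℕ} (Γ : Submodule ℚ (Fin n → ℚ))
    (hr : Module.finrank ℚ Γ = n - 1) :
    ∃ v : Fin n → ℚ, ∀ w : Fin n → ℚ, ∃ g ∈ Γ, ∃ c : ℚ, w = g + c • v := by
  obtain ⟨W, hW⟩ := Γ.exists_isCompl
  have h1 := Submodule.finrank_add_eq_of_isCompl hW
  rw [Module.finrank_fin_fun] at h1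
  have h2 : Module.finrank ℚ W ≤ 1 := by omega
  obtain ⟨v, hv⟩ := finrank_le_one_iff.mp h2
  refine ⟨v, fun w => ?_⟩
  have h3 : w ∈ Γ ⊔ W := by rw [hW.sup_eq_top]; trivial
  obtain ⟨g, hg, y, hy, rfl⟩ := Submodule.mem_sup.mp h3
  obtain ⟨c, hc⟩ := hv ⟨y, hy⟩
  refine ⟨g, hg, c, ?_⟩
  have := congrArg Subtype.val hc
  simp only [Submodule.coe_smul] at this
  rw [this]

theorem wedge {n k : ℕ} (h : Fin n → List (Fin k)) (hr : morphRank h = n - 1)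
    (σ τ : Fin n → MvPolynomial (Fin k) ℚ)
    (hσ : ∀ a, ∑ j, σ j * fox MvPolynomial.X (h j) a = 0)
    (hτ : ∀ a, ∑ j, τ j * fox MvPolynomial.X (h j) a = 0) (i j : Fin n) :
    σ i * τ j = σ j * τ i := by
  obtain ⟨v, hv⟩ := exists_compl_vec (GammaSpace h) hr
  have hex : ∀ i : Fin n, ∃ (C : Fin k → ℚ) (d : ℚ), ∀ l,
      (∑ a, C a * ((h l).count a : ℚ)) + d * v l = if i = l then 1 else 0 := by
    intro i
    obtain ⟨g, hg, d, hgd⟩ := hv (Pi.single i 1)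
    obtain ⟨C, hC⟩ := (Submodule.mem_span_range_iff_exists_fun ℚ).mp hg
    refine ⟨C, d, fun l => ?_⟩
    have := congrFun hgd l
    rw [← hC] at this
    simp only [Pi.single_apply, Pi.add_apply, Finset.sum_apply, Pi.smul_apply, smul_eq_mul,
      gamVec] at this
    rw [← this]
    simp [eq_comm]
  choose C d hCd using hex
  let N : Matrix (Fin n) (Fin n) (MvPolynomial (Fin k) ℚ) := fun i l =>
    (∑ a, MvPolynomial.C (C i a) * fox MvPolynomial.X (h l) a) + MvPolynomial.C (d i * v l)
  let ev : MvPolynomial (Fin k) ℚ →+* ℚ := MvPolynomial.eval (fun _ => 1)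
  have hN : N.det ≠ 0 := by
    intro h0
    have h1 : ev N.det = 1 := by
      rw [RingHom.map_det]
      have : ev.mapMatrix N = 1 := by
        ext i l
        rw [RingHom.mapMatrix_apply, Matrix.map_apply, Matrix.one_apply, ← hCd i l]
        simp only [N, map_add, map_sum, map_mul, fox_map]
        simp [ev, fox_one]
      rw [this, Matrix.det_one]
    rw [h0, map_zero] at h1
    exact zero_ne_one h1
  have key : ∀ ρ : Fin n → MvPolynomial (Fin k) ℚ,
      (∀ a, ∑ j, ρ j * fox MvPolynomial.X (h j) a = 0) → ∀ i,
      N.mulVec ρ i = MvPolynomial.C (d i) * ∑ l, MvPolynomial.C (v l) * ρ l := by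
    intro ρ hρ i
    simp only [Matrix.mulVec, dotProduct, N, add_mul, Finset.sum_add_distrib, Finset.sum_mul,
      Finset.mul_sum]
    rw [Finset.sum_comm]
    have : ∀ a, ∑ l, MvPolynomial.C (C i a) * fox MvPolynomial.X (h l) a * ρ l = 0 := by
      intro a
      rw [← mul_zero (MvPolynomial.C (C i a)), ← hρ a, Finset.mul_sum]
      exact Finset.sum_congr rfl (fun l _ => by ring)
    rw [Finset.sum_eq_zero (fun a _ => this a), zero_add]
    simp only [map_mul, mul_assoc]
  set s := ∑ l, MvPolynomial.C (v l) * σ l with hs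
  set t := ∑ l, MvPolynomial.C (v l) * τ l with ht
  have h1 : t • σ - s • τ = 0 := by
    apply Matrix.eq_zero_of_mulVec_eq_zero hN
    rw [Matrix.mulVec_sub, Matrix.mulVec_smul, Matrix.mulVec_smul]
    funext i
    simp only [Pi.sub_apply, Pi.smul_apply, smul_eq_mul, key σ hσ, key τ hτ, Pi.zero_apply]
    rw [← hs, ← ht]; ring
  have h2 : ∀ l, t * σ l = s * τ l := fun l => by
    have := congrFun h1 l
    simpa [sub_eq_zero] using this
  by_cases hs0 : s = 0
  · have : σ = 0 := by
      apply Matrix.eq_zero_of_mulVec_eq_zero hN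
      funext i
      rw [key σ hσ, ← hs, hs0]; simp
    simp [this]
  · apply mul_left_cancel₀ hs0
    linear_combination (-σ i) * h2 j + σ j * h2 i

/-- Fox vector of an equation, generic weights. -/
noncomputable def gen {n : ℕ} (E : List (Fin n) × List (Fin n)) (j : Fin n) :
    MvPolynomial (Fin n) ℚ := fox MvPolynomial.X E.1 j - fox MvPolynomial.X E.2 j

theorem aeval_gen {n k : ℕ} (h : Fin n → List (Fin k)) (E : List (Fin n) × List (Fin n))
    (j : Fin n) : MvPolynomial.aeval (wt h) (gen E j) =
      fox (wt h) E.1 j - fox (wt h) E.2 j := by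
  have := fox_map (MvPolynomial.aeval (R := ℚ) (wt h)).toRingHom MvPolynomial.X
  simp only [AlgHom.toRingHom_eq_coe, RingHom.coe_coe, MvPolynomial.aeval_X] at this
  rw [gen, map_sub, this, this]

theorem sol_orth {n k : ℕ} (h : Fin n → List (Fin k)) (E : List (Fin n) × List (Fin n))
    (a : Fin k) :
    ∑ j, MvPolynomial.aeval (wt h) (gen E j) * fox MvPolynomial.X (h j) a =
      fox MvPolynomial.X (E.1.flatMap h) a - fox MvPolynomial.X (E.2.flatMap h) a := by
  simp only [aeval_gen, fox_flatMap, sub_mul, Finset.sum_sub_distrib]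
  rfl

theorem gen_ne_zero {n k : ℕ} (h : Fin n → List (Fin k)) (hr : morphRank h = n - 1)
    (E : List (Fin n) × List (Fin n)) (hE : E.1 ≠ E.2) :
    ∃ j, MvPolynomial.aeval (wt h) (gen E j) ≠ 0 := by
  by_contra! H
  apply hE
  have hc0 : ∀ i, h i ≠ [] → MvPolynomial.constantCoeff (wt h i) = 0 := by
    intro i hi
    obtain ⟨b, w, hbw⟩ := List.exists_cons_of_ne_nil hi
    simp [wt, hbw]
  have hc1 : ∀ i, h i = [] → MvPolynomial.constantCoeff (wt h i) = 1 := by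
    intro i hi
    simp [wt, hi]
  refine fox_inj MvPolynomial.constantCoeff (wt h) ?_ ?_ ?_ _ _ ?_
  · intro i
    by_cases hi : h i = []
    · rw [hc1 i hi]; norm_num
    · rw [hc0 i hi]
  · intro i
    rw [wt, prod_X_eq]
    simp
  · intro i j hij
    by_contra! hcon
    have hi : h i = [] := by by_contra hi; exact hcon.1 (hc0 i hi)
    have hj : h j = [] := by by_contra hj; exact hcon.2 (hc0 j hj)
    have hz : ∀ l, h l = [] → ∀ g ∈ GammaSpace h, g l = 0 := by
      intro l hl g hg
      induction hg using Submodule.span_induction with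
      | mem g hg => obtain ⟨a, rfl⟩ := hg; simp [gamVec, hl]
      | zero => simp
      | add x y _ _ hx hy => simp [hx, hy]
      | smul r x _ hx => simp [hx]
    obtain ⟨v, hv⟩ := exists_compl_vec (GammaSpace h) hr
    obtain ⟨g, hg, c, hgc⟩ := hv (Pi.single i 1)
    obtain ⟨g', hg', c', hgc'⟩ := hv (Pi.single j 1)
    have e1 := congrFun hgc i
    have e2 := congrFun hgc j
    have e3 := congrFun hgc' j
    simp only [Pi.add_apply, Pi.smul_apply, smul_eq_mul, hz i hi g hg, hz j hj g hg,
      hz j hj g' hg', Pi.single_eq_same, Pi.single_eq_of_ne hij.symm, zero_add] at e1 e2 e3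
    rcases mul_eq_zero.mp e2.symm with h0 | h0
    · rw [h0] at e1; simp at e1
    · rw [h0] at e3; simp at e3
  · funext j
    have := H j
    rw [aeval_gen] at this
    exact sub_eq_zero.mp this


/-- if `h` is a common solution of rank `n-1` of nontrivial equations `E`
and `E'`, and `h'` is a solution of `E` of rank `n-1` that does not solve `E'`, then `h` and
`h'` are not linearly equivalent. -/
theorem not_linearly_equivalent {n c₁ c₂ : ℕ} (E E' : List (Fin n) × List (Fin n))
    (hEnt : E.1 ≠ E.2) (hE'nt : E'.1 ≠ E'.2)
    (h : Fin n → List (Fin c₁)) (h' : Fin n → List (Fin c₂))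
    (hsolE : IsSolutionE h E) (hsolE' : IsSolutionE h E')
    (hrank : morphRank h = n - 1)
    (h'solE : IsSolutionE h' E) (h'nsolE' : ¬ IsSolutionE h' E')
    (h'rank : morphRank h' = n - 1) :
    GammaSpace h ≠ GammaSpace h' := by
  intro hΓ
  apply h'nsolE'
  have w1 := wedge h hrank (fun j => MvPolynomial.aeval (wt h) (gen E j))
    (fun j => MvPolynomial.aeval (wt h) (gen E' j))
    (fun a => by rw [sol_orth, show E.1.flatMap h = E.2.flatMap h from hsolE, sub_self])
    (fun a => by rw [sol_orth, show E'.1.flatMap h = E'.2.flatMap h from hsolE', sub_self])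
  have w2 : ∀ i j, MvPolynomial.aeval (wt h') (gen E i) * MvPolynomial.aeval (wt h') (gen E' j) =
      MvPolynomial.aeval (wt h') (gen E j) * MvPolynomial.aeval (wt h') (gen E' i) := by
    intro i j
    have h0 := ker_transfer h h' (fun m m' => by rw [expo_iff, expo_iff, hΓ])
      (gen E i * gen E' j - gen E j * gen E' i) (by
        rw [map_sub, map_mul, map_mul, sub_eq_zero]; exact w1 i j)
    rw [map_sub, map_mul, map_mul, sub_eq_zero] at h0
    exact h0
  obtain ⟨i, hi⟩ := gen_ne_zero h' h'rank E hEnt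
  refine fox_inj (R := MvPolynomial (Fin c₂) ℚ) MvPolynomial.constantCoeff MvPolynomial.X
    (by simp) (fun a => MvPolynomial.X_ne_zero a) (by simp) _ _ ?_
  funext a
  rw [← sub_eq_zero, ← sol_orth]
  apply mul_left_cancel₀ hi
  rw [mul_zero, Finset.mul_sum]
  simp only [← mul_assoc, w2 i]
  have h1 := sol_orth h' E a
  rw [show E.1.flatMap h' = E.2.flatMap h' from h'solE, sub_self] at h1
  rw [← mul_zero (MvPolynomial.aeval (wt h') (gen E' i)), ← h1, Finset.mul_sum]
  exact Finset.sum_congr rfl (fun l _ => by ring)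

end WordEquations
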